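/- Let r and w be real numbers with 0 < r < w, let t ≥ 1 and u ≥ 1 be integers, and let b be an integer with 0 ≤ b < u·t. Put h = ⌊b/u⌋, z = b − h·u (so 0 ≤ z < u), and δ_z = 1 if z ≠ 0 and δ_z = 0 if z = 0. Then h + δ_z ≤ t and h·r + δ_z·(2^{z−u}·r + (1 − 2^{z−u})·w) + (t − h − δ_z)·(2^{−u}·r + (1 − 2^{−u})·w) > t·r. -/

import Mathlib

/-- For `0 < r < w`, integers `t, u ≥ 1`, `0 ≤ b < u·t`,
`h = ⌊b/u⌋`, `z = b - h·u`, and `δ = 1` if `z ≠ 0` else `δ = 0`, we have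
`h + δ ≤ t` and
`h·r + δ·(2^(z-u)·r + (1-2^(z-u))·w) + (t-h-δ)·(2^(-u)·r + (1-2^(-u))·w) > t·r`. -/
theorem randomized_advice_lower_bound_arith
    (r w : ℝ) (hr : 0 < r) (hrw : r < w)
    (t u : ℕ) (ht : 1 ≤ t) (hu : 1 ≤ u)
    (b : ℕ) (hb : b < u * t)
    (h z : ℕ) (hh : h = b / u) (hz : z = b - h * u)
    (δ : ℝ) (hδ : δ = if z ≠ 0 then 1 else 0) :
    (h : ℝ) + δ ≤ (t : ℝ) ∧
      (t : ℝ) * r <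
        (h : ℝ) * r
          + δ * ((2 : ℝ) ^ ((z : ℤ) - (u : ℤ)) * r
              + (1 - (2 : ℝ) ^ ((z : ℤ) - (u : ℤ))) * w)
          + ((t : ℝ) - (h : ℝ) - δ) * ((2 : ℝ) ^ (-(u : ℤ)) * r
              + (1 - (2 : ℝ) ^ (-(u : ℤ))) * w) := by
  have hht : h < t := by
    rw [hh]; exact Nat.div_lt_of_lt_mul hb
  have hzu : z < u := by
    have h1 := Nat.mod_lt b (show 0 < u by omega)
    have h2 := Nat.div_add_mod b u
    rw [← hh, mul_comm] at h2
    omega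
  have hht' : (h : ℝ) + 1 ≤ t := by exact_mod_cast hht
  have hp : (2 : ℝ) ^ ((z : ℤ) - (u : ℤ)) < 1 :=
    zpow_lt_one_of_neg₀ (by norm_num) (by omega)
  have hq : (2 : ℝ) ^ (-(u : ℤ)) < 1 :=
    zpow_lt_one_of_neg₀ (by norm_num) (by omega)
  generalize (2 : ℝ) ^ ((z : ℤ) - (u : ℤ)) = p at *
  generalize (2 : ℝ) ^ (-(u : ℤ)) = q at *
  have hw : 0 < w - r := by linarith
  have h1 : 0 < (w - r) * (1 - p) := mul_pos hw (by linarith)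
  have h2 : 0 < (w - r) * (1 - q) := mul_pos hw (by linarith)
  by_cases h0 : z = 0
  · have hd : δ = 0 := by simp [hδ, h0]
    subst hd
    refine ⟨by linarith, ?_⟩
    have h3 : 0 < ((t : ℝ) - h) * ((w - r) * (1 - q)) := mul_pos (by linarith) h2
    linarith
  · have hd : δ = 1 := by simp [hδ, h0]
    subst hd
    refine ⟨hht', ?_⟩
    have h3 : 0 ≤ ((t : ℝ) - h - 1) * ((w - r) * (1 - q)) :=
      mul_nonneg (by linarith) h2.le
    linarith
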